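/- For μ ∈ ℂ with Re μ > γ - 1 where γ = q - 1/2 + 1 (the case d = 1, 𝔽 = ℝ), the integral κ_μ = ∫_{B_q} det(I - wᵀw)^{μ-γ} dw over the matrix ball B_q = {w ∈ M_q(ℝ) : wᵀw < I} converges absolutely. -/

import Mathlib

open MeasureTheory Matrix

theorem integrableOn_one_sub_sq_rpow (n : ℕ) {a : ℝ} (ha : -1 < a) :
    IntegrableOn (fun y : ℝ => y ^ n • (1 - y ^ 2) ^ a) (Set.Ioo 0 1) := by
  have hint : IntegrableOn (fun y : ℝ => (1 - y) ^ a) (Set.Ioo 0 1) := by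
    have h := (intervalIntegral.intervalIntegrable_rpow' (a := 0) (b := 1) ha).comp_sub_left 1
    have h' := h.symm
    simp only [sub_zero, sub_self] at h'
    rwa [intervalIntegrable_iff_integrableOn_Ioo_of_le zero_le_one] at h'
  refine (hint.mul_const (1 + 2 ^ a)).mono' (by fun_prop) ?_
  filter_upwards [ae_restrict_mem measurableSet_Ioo] with y ⟨hy0, hy1⟩
  have hfac : (1 - y ^ 2) ^ a = (1 - y) ^ a * (1 + y) ^ a := by
    rw [← Real.mul_rpow (by linarith) (by linarith)]
    ring_nf
  have hle : (1 + y) ^ a ≤ 1 + 2 ^ a := by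
    rcases le_total a 0 with h | h
    · have := Real.rpow_le_one_of_one_le_of_nonpos (x := 1 + y) (by linarith) h
      have : (0 : ℝ) ≤ 2 ^ a := by positivity
      linarith
    · have := Real.rpow_le_rpow (x := 1 + y) (y := 2) (by linarith) (by linarith) h
      linarith
  have h1 : (0 : ℝ) ≤ (1 - y) ^ a := Real.rpow_nonneg (by linarith) _
  have h2 : (0 : ℝ) ≤ (1 + y) ^ a := Real.rpow_nonneg (by linarith) _
  have hpow : y ^ n ≤ 1 := pow_le_one₀ hy0.le hy1.le
  rw [smul_eq_mul, hfac, Real.norm_of_nonneg (by positivity)]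
  calc y ^ n * ((1 - y) ^ a * (1 + y) ^ a) ≤ 1 * ((1 - y) ^ a * (1 + 2 ^ a)) := by gcongr
    _ = _ := one_mul _

theorem lintegral_one_sub_dotProduct_rpow_lt_top (q : ℕ) {a : ℝ} (ha : -1 < a) :
    ∫⁻ u : Fin q → ℝ, {u : Fin q → ℝ | u ⬝ᵥ u < 1}.indicator
      (fun u => ENNReal.ofReal ((1 - u ⬝ᵥ u) ^ a)) u < ⊤ := by
  have hball : IntegrableOn (fun x : EuclideanSpace ℝ (Fin q) => (1 - ‖x‖ ^ 2) ^ a)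
      (Metric.ball 0 1) := by
    rcases Nat.eq_zero_or_pos q with rfl | hq
    · refine (integrableOn_const (C := (1 : ℝ)) (by finiteness)).congr_fun
        (fun x _ => ?_) measurableSet_ball
      simp [Subsingleton.elim x 0]
    · have : Nonempty (Fin q) := ⟨⟨0, hq⟩⟩
      exact (integrableOn_fun_norm_addHaar volume).2 (integrableOn_one_sub_sq_rpow _ ha)
  have hnorm (u : Fin q → ℝ) : ‖WithLp.toLp 2 u‖ ^ 2 = u ⬝ᵥ u := by
    rw [EuclideanSpace.norm_sq_eq]
    simp [dotProduct, sq]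
  have hlin := hball.lintegral_lt_top
  rw [← lintegral_indicator measurableSet_ball,
    ← (PiLp.volume_preserving_toLp (Fin q)).lintegral_comp_emb
      (MeasurableEquiv.toLp 2 (Fin q → ℝ)).measurableEmbedding] at hlin
  refine (lintegral_congr fun u => ?_).trans_lt hlin
  by_cases hu : u ⬝ᵥ u < 1
  · have : WithLp.toLp 2 u ∈ Metric.ball (0 : EuclideanSpace ℝ (Fin q)) 1 := by
      rw [mem_ball_zero_iff, ← sq_lt_one_iff₀ (norm_nonneg _), hnorm]
      exact hu
    rw [Set.indicator_of_mem this, Set.indicator_of_mem (by exact hu), hnorm]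
  · have : WithLp.toLp 2 u ∉ Metric.ball (0 : EuclideanSpace ℝ (Fin q)) 1 := by
      rw [mem_ball_zero_iff, ← sq_lt_one_iff₀ (norm_nonneg _), hnorm]
      exact hu
    rw [Set.indicator_of_notMem this, Set.indicator_of_notMem (by exact hu)]

/-- The function `N ↦ det N ^ a` on positive definite matrices, extended by zero. -/
noncomputable def posDefDetRpow {ι : Type*} [Fintype ι] [DecidableEq ι] (a : ℝ)
    (N : Matrix ι ι ℝ) : ENNReal :=
  {N : Matrix ι ι ℝ | N.PosDef}.indicator (fun N => ENNReal.ofReal (N.det ^ a)) N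

section
variable {ι : Type*} [Fintype ι] [DecidableEq ι]

theorem posDefDetRpow_of_posDef {N : Matrix ι ι ℝ} (hN : N.PosDef) (a : ℝ) :
    posDefDetRpow a N = ENNReal.ofReal (N.det ^ a) := Set.indicator_of_mem (by exact hN) _

theorem posDefDetRpow_of_not_posDef {N : Matrix ι ι ℝ} (hN : ¬ N.PosDef) (a : ℝ) :
    posDefDetRpow a N = 0 := Set.indicator_of_notMem (by exact hN) _

theorem measurableSet_setOf_posDef {X : Type*} [TopologicalSpace X] [MeasurableSpace X]
    [OpensMeasurableSpace X] {N : X → Matrix ι ι ℝ} (hN : Continuous N)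
    (hherm : ∀ x, (N x).IsHermitian) : MeasurableSet {x | (N x).PosDef} := by
  have hset : {x | (N x).PosDef} = {x | ∀ y, 0 ≤ star y ⬝ᵥ (N x *ᵥ y)} ∩ {x | (N x).det ≠ 0} := by
    ext x
    refine ⟨fun h => ⟨fun y => h.posSemidef.dotProduct_mulVec_nonneg y, h.det_pos.ne'⟩, fun h => ?_⟩
    exact (PosSemidef.of_dotProduct_mulVec_nonneg (hherm x) h.1).posDef_iff_det_ne_zero.2 h.2
  rw [hset, Set.ofPred_forall]
  refine (isClosed_iInter fun y => isClosed_le continuous_const ?_).measurableSet.inter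
    (isOpen_ne_fun hN.matrix_det continuous_const).measurableSet
  exact continuous_const.dotProduct (hN.matrix_mulVec continuous_const)

theorem measurable_posDefDetRpow {X : Type*} [TopologicalSpace X] [MeasurableSpace X]
    [OpensMeasurableSpace X] {N : X → Matrix ι ι ℝ} (hN : Continuous N)
    (hherm : ∀ x, (N x).IsHermitian) (a : ℝ) : Measurable fun x => posDefDetRpow a (N x) := by
  have h : Measurable ({x | (N x).PosDef}.indicator
      fun x => ENNReal.ofReal ((N x).det ^ a)) :=
    ((hN.matrix_det.measurable.pow_const a).ennreal_ofReal).indicator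
      (measurableSet_setOf_posDef hN hherm)
  exact h

theorem posDefDetRpow_mul_one_sub_vecMulVec_mul_le (a : ℝ) {A : Matrix ι ι ℝ} (hA : A.det ≠ 0)
    (u : ι → ℝ) :
    posDefDetRpow a (A * (1 - vecMulVec u u) * Aᵀ) ≤ ENNReal.ofReal ((A.det ^ 2) ^ a) *
      {u : ι → ℝ | u ⬝ᵥ u < 1}.indicator (fun u => ENNReal.ofReal ((1 - u ⬝ᵥ u) ^ a)) u := by
  by_cases hN : (A * (1 - vecMulVec u u) * Aᵀ).PosDef
  · have hdet : (A * (1 - vecMulVec u u) * Aᵀ).det = A.det ^ 2 * (1 - u ⬝ᵥ u) := by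
      rw [det_mul, det_mul, det_transpose, vecMulVec_eq Unit, det_one_sub_mul_comm]
      simp
      ring
    have hpos := hN.det_pos
    rw [hdet] at hpos
    have hu : 0 < 1 - u ⬝ᵥ u := pos_of_mul_pos_right hpos (sq_nonneg _)
    rw [posDefDetRpow_of_posDef hN, hdet,
      Set.indicator_of_mem (show u ∈ {u : ι → ℝ | u ⬝ᵥ u < 1} from sub_pos.1 hu),
      Real.mul_rpow (sq_nonneg _) hu.le, ENNReal.ofReal_mul (by positivity)]
  · simp [posDefDetRpow_of_not_posDef hN]

theorem lintegral_posDefDetRpow_sub_vecMulVec_le (a : ℝ) (M : Matrix ι ι ℝ) :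
    ∫⁻ v : ι → ℝ, posDefDetRpow a (M - vecMulVec v v) ≤
      posDefDetRpow (a + 1 / 2) M * ∫⁻ u : ι → ℝ, {u : ι → ℝ | u ⬝ᵥ u < 1}.indicator
        (fun u => ENNReal.ofReal ((1 - u ⬝ᵥ u) ^ a)) u := by
  by_cases hM : M.PosDef
  · obtain ⟨A, hMA⟩ : ∃ A : Matrix ι ι ℝ, M = A * Aᵀ := by
      open scoped MatrixOrder in
      open scoped Matrix.Norms.L2Operator in
      obtain ⟨B, hB⟩ := CStarAlgebra.nonneg_iff_eq_star_mul_self.mp hM.posSemidef.nonneg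
      exact ⟨Bᵀ, by simpa [star_eq_conjTranspose, conjTranspose_eq_transpose_of_trivial] using hB⟩
    have hdetM : M.det = A.det ^ 2 := by rw [hMA, det_mul, det_transpose, sq]
    have hMpos := hM.det_pos
    have hA : A.det ≠ 0 := by
      rintro h
      simp [hdetM, h] at hMpos
    have hvol : (volume : Measure (ι → ℝ)) =
        ENNReal.ofReal |A.det| • Measure.map (toLin' A) volume := by
      rw [Real.map_matrix_volume_pi_eq_smul_volume_pi hA, smul_smul,
        ← ENNReal.ofReal_mul (abs_nonneg _), ← abs_mul, mul_inv_cancel₀ hA]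
      simp
    have hconj (u : ι → ℝ) : M - vecMulVec (toLin' A u) (toLin' A u) =
        A * (1 - vecMulVec u u) * Aᵀ := by
      rw [hMA, mul_sub, sub_mul, mul_one, toLin'_apply, mul_vecMulVec, vecMulVec_mul,
        vecMul_transpose]
    have habs : ENNReal.ofReal |A.det| * ENNReal.ofReal ((A.det ^ 2) ^ a) =
        posDefDetRpow (a + 1 / 2) M := by
      rw [posDefDetRpow_of_posDef hM, ← ENNReal.ofReal_mul (abs_nonneg _), ← hdetM,
        Real.rpow_add hMpos, ← Real.sqrt_eq_rpow, hdetM, Real.sqrt_sq_eq_abs, mul_comm]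
    calc ∫⁻ v : ι → ℝ, posDefDetRpow a (M - vecMulVec v v)
        = ENNReal.ofReal |A.det| *
          ∫⁻ v, posDefDetRpow a (M - vecMulVec v v) ∂(Measure.map (toLin' A) volume) := by
          conv_lhs => rw [hvol, lintegral_smul_measure, smul_eq_mul]
      _ ≤ ENNReal.ofReal |A.det| *
          ∫⁻ u : ι → ℝ, ENNReal.ofReal ((A.det ^ 2) ^ a) * {u : ι → ℝ | u ⬝ᵥ u < 1}.indicator
            (fun u => ENNReal.ofReal ((1 - u ⬝ᵥ u) ^ a)) u := by
          refine mul_le_mul_right ?_ _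
          refine (lintegral_map_le (μ := volume) _ (toLin' A)).trans (lintegral_mono fun u => ?_)
          rw [hconj]
          exact posDefDetRpow_mul_one_sub_vecMulVec_mul_le a hA u
      _ = _ := by
          rw [lintegral_const_mul' _ _ ENNReal.ofReal_ne_top, ← mul_assoc, habs]
  · have hzero (v : ι → ℝ) : posDefDetRpow a (M - vecMulVec v v) = 0 := by
      refine posDefDetRpow_of_not_posDef (fun h => hM ?_) a
      simpa using h.add_posSemidef (posSemidef_vecMulVec_self_star v)
    simp [hzero]

end

theorem lintegral_posDefDetRpow_one_sub_transpose_mul_self_lt_top (q n : ℕ) {a : ℝ}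
    (ha : -1 < a) :
    ∫⁻ w : Fin n → Fin q → ℝ, posDefDetRpow a (1 - (of w)ᵀ * of w) < ⊤ := by
  induction n generalizing a with
  | zero =>
    have h (w : Fin 0 → Fin q → ℝ) : posDefDetRpow a (1 - (of w)ᵀ * of w) = 1 := by
      have : (of w)ᵀ * of w = 0 := by ext; simp [mul_apply]
      rw [this, sub_zero, posDefDetRpow_of_posDef PosDef.one]
      simp
    simp_rw [h]
    simp [volume_pi]
  | succ n ih =>
    have hcons (v : Fin q → ℝ) (w : Fin n → Fin q → ℝ) :
        1 - (of (Fin.cons v w : Fin (n + 1) → Fin q → ℝ))ᵀ *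
          of (Fin.cons v w : Fin (n + 1) → Fin q → ℝ) =
        (1 - (of w)ᵀ * of w) - vecMulVec v v := by
      ext i j
      simp [mul_apply, Fin.sum_univ_succ, vecMulVec_apply]
      ring
    have hmeas : Measurable fun w : Fin (n + 1) → Fin q → ℝ =>
        posDefDetRpow a (1 - (of w)ᵀ * of w) := by
      refine measurable_posDefDetRpow ?_ (fun w => ?_) a
      · have : Continuous fun w : Fin (n + 1) → Fin q → ℝ => of w := continuous_id
        exact continuous_const.sub (this.matrix_transpose.matrix_mul this)
      · exact isHermitian_one.sub (isHermitian_conjTranspose_mul_self (of w))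
    have he := (volume_preserving_piFinSuccAbove (fun _ : Fin (n + 1) => Fin q → ℝ) 0).symm
    rw [← he.lintegral_comp hmeas, Measure.volume_eq_prod,
      lintegral_prod_symm' (fun z => posDefDetRpow a (1 - (of _)ᵀ * of _))
        (hmeas.comp he.measurable)]
    have hsymm (v : Fin q → ℝ) (w : Fin n → Fin q → ℝ) :
        (MeasurableEquiv.piFinSuccAbove (fun _ : Fin (n + 1) => Fin q → ℝ) 0).symm (v, w) =
          Fin.cons v w := by
      simp [MeasurableEquiv.piFinSuccAbove, Fin.consEquiv]
    simp only [hsymm, hcons]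
    refine (lintegral_mono fun w => lintegral_posDefDetRpow_sub_vecMulVec_le a _).trans_lt ?_
    have hC := lintegral_one_sub_dotProduct_rpow_lt_top q ha
    rw [lintegral_mul_const' _ _ hC.ne]
    exact ENNReal.mul_lt_top (ih (by linarith)) hC

/-- For μ ∈ ℂ with Re μ > γ - 1, γ = q + 1/2 (the real case d = 1), the integral
κ_μ = ∫_{B_q} det(I - wᵀw)^{μ-γ} dw over the matrix ball
B_q = {w ∈ M_q(ℝ) : wᵀw < I} converges absolutely. -/
theorem kappa_integrable (q : ℕ) (μ : ℂ) (hμ : (q : ℝ) + 1 / 2 - 1 < μ.re) :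
    IntegrableOn
      (fun w : Fin q → Fin q → ℝ =>
        ((Matrix.det (1 - (Matrix.of w)ᵀ * Matrix.of w) : ℝ) : ℂ) ^
          (μ - ((q : ℂ) + 1 / 2)))
      {w : Fin q → Fin q → ℝ | (1 - (Matrix.of w)ᵀ * Matrix.of w).PosDef}
      volume := by
  have hcont : Continuous fun w : Fin q → Fin q → ℝ => 1 - (of w)ᵀ * of w := by
    have : Continuous fun w : Fin q → Fin q → ℝ => of w := continuous_id
    exact continuous_const.sub (this.matrix_transpose.matrix_mul this)
  have hset : MeasurableSet {w : Fin q → Fin q → ℝ | (1 - (of w)ᵀ * of w).PosDef} :=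
    measurableSet_setOf_posDef hcont fun w =>
      isHermitian_one.sub (isHermitian_conjTranspose_mul_self (of w))
  have hre : (μ - ((q : ℂ) + 1 / 2)).re = μ.re - (q + 1 / 2) := by simp
  refine ⟨((Complex.measurable_ofReal.comp hcont.matrix_det.measurable).pow_const
    _).aestronglyMeasurable, ?_⟩
  rw [hasFiniteIntegral_iff_norm, ← lintegral_indicator hset]
  refine lt_of_eq_of_lt (lintegral_congr fun w => ?_)
    (lintegral_posDefDetRpow_one_sub_transpose_mul_self_lt_top q q
      (a := μ.re - (q + 1 / 2)) (by linarith))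
  by_cases hw : (1 - (of w)ᵀ * of w).PosDef
  · rw [Set.indicator_of_mem (by exact hw), posDefDetRpow_of_posDef hw,
      Complex.norm_cpow_eq_rpow_re_of_pos hw.det_pos, hre]
  · rw [Set.indicator_of_notMem (by exact hw), posDefDetRpow_of_not_posDef hw]
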